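/- Let (A, +, ·) be a pre-Lie ring of cardinality p^n for a prime p > 3 and a natural number n, satisfying Property 3, let ρ, σ_j, E_{j,a}, E_j, W and W(a, b) be as in the context, let Ω : A → A be the inverse of the bijection W, and define a ∘' b = a + b + W(Ω(a), b) and a *' b = W(Ω(a), b). Then (A, +, ∘') is a pseudobrace; in particular: (1) for every a ∈ A there exists a' ∈ A with a ∘' a' = 0; (2) a *' (b + c) = a *' b + a *' c for all a, b, c ∈ A; (3) setting A^1 = A and A^{i+1} = the additive subgroup of (A, +) generated by {a *' x : a ∈ A, x ∈ A^i}, one has A^{n+1} = 0; and (4) for all natural numbers i, j ≥ 1 and all a, b ∈ A: a^{∘'i} ∘' a^{∘'j} = a^{∘'(i+j)}, (a^{∘'i} ∘' a^{∘'j}) ∘' b = a^{∘'(i+j)} ∘' b, and a^{∘'i} ∘' b equals the i-fold product a ∘' (a ∘' (⋯ (a ∘' b)⋯)), where a^{∘'i} denotes the i-fold ∘'-product of a with itself. -/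

import Mathlib

/-- A pre-Lie ring: an abelian group with a bi-additive multiplication satisfying
`(x·y)·z − x·(y·z) = (y·x)·z − y·(x·z)`. -/
class PreLieRing (A : Type*) extends AddCommGroup A where
  mul : A → A → A
  add_mul' : ∀ a b c : A, mul (a + b) c = mul a c + mul b c
  mul_add' : ∀ a b c : A, mul a (b + c) = mul a b + mul a c
  pre_lie : ∀ x y z : A,
    mul (mul x y) z - mul x (mul y z) = mul (mul y x) z - mul y (mul x z)

namespace PreLieRing

variable {A : Type*} [PreLieRing A]

/-- `ann (p^i) = {a : p^i • a = 0}`. -/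
def ann (p i : ℕ) : Set A := {a : A | (p ^ i : ℕ) • a = 0}

/-- `p^i • A = {p^i • a : a ∈ A}`. -/
def pA (p i : ℕ) : Set A := Set.range (fun a : A => (p ^ i : ℕ) • a)

/-- Nested left-normed product `a₁ · (a₂ · (⋯ · (aₘ · b)⋯))`. -/
def nestedMul : List A → A → A
  | [], b => b
  | a :: l, b => mul a (nestedMul l b)

/-- `Lpow a m x = L_a^m(x)`, the `m`-fold left multiplication by `a`. -/
def Lpow (a : A) (m : ℕ) (x : A) : A := (fun y => mul a y)^[m] x

/-- Property 3 (with `c = ⌊(p-1)/4⌋`): products of `c` elements lie in `p·A`, and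
products of `c` elements applied to `ann(pⁱ)` lie in `p·ann(pⁱ)`. -/
def Property3 (p : ℕ) (A : Type*) [PreLieRing A] : Prop :=
  (∀ (l : List A) (b : A), l.length + 1 = (p - 1) / 4 → nestedMul l b ∈ pA p 1) ∧
  (∀ i : ℕ, 1 ≤ i → ∀ l : List A, l.length = (p - 1) / 4 →
    ∀ b ∈ ann p i, ∃ y ∈ ann p i, nestedMul l b = p • y)

end PreLieRing

namespace PreLieRing

variable {A : Type*} [PreLieRing A]

/-- `sVal p j = s_j`, the largest `s` with `p^s ∣ j!`. -/
def sVal (p j : ℕ) : ℕ := (Nat.factorial j).factorization p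

/-- `etaVal p j = η_j = ⌊(p-1)/4⌋ · s_j`. -/
def etaVal (p j : ℕ) : ℕ := ((p - 1) / 4) * sVal p j

/-- `Ediag p ρ a j = E_j(a)`:
`E_j(a) = L_a^{j-η_j}(ρ^{s_j}(L_a^{η_j−1}(a)))` if `η_j ≥ 1`, and
`E_j(a) = L_a^{j-1}(a)` if `η_j = 0` (with the junk value `0` for `j = 0`). -/
noncomputable def Ediag (p : ℕ) (ρ : A → A) (a : A) (j : ℕ) : A :=
  if j = 0 then 0
  else if etaVal p j = 0 then Lpow a (j - 1) a
  else Lpow a (j - etaVal p j) (ρ^[sVal p j] (Lpow a (etaVal p j - 1) a))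

/-- `Eop p ρ a j b = E_{j,a}(b) = L_a^{j-η_j}(ρ^{s_j}(L_a^{η_j}(b)))`
(with the junk value `0` for `j = 0`). -/
noncomputable def Eop (p : ℕ) (ρ : A → A) (a : A) (j : ℕ) (b : A) : A :=
  if j = 0 then 0
  else Lpow a (j - etaVal p j) (ρ^[sVal p j] (Lpow a (etaVal p j) b))

/-- `Wmap p σ ρ a = W(a) = Σ_{j ≥ 1} σ_j • E_j(a)` (a finite sum, as all but
finitely many terms vanish). -/
noncomputable def Wmap (p : ℕ) (σ : ℕ → ℤ) (ρ : A → A) (a : A) : A :=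
  ∑ᶠ j : ℕ, σ j • Ediag p ρ a j

/-- `Wop p σ ρ a b = W(a, b) = Σ_{j ≥ 1} σ_j • E_{j,a}(b)` (a finite sum). -/
noncomputable def Wop (p : ℕ) (σ : ℕ → ℤ) (ρ : A → A) (a b : A) : A :=
  ∑ᶠ j : ℕ, σ j • Eop p ρ a j b

end PreLieRing

open PreLieRing

/-- `cpow f a i = a^{∘(i+1)}`: the `(i+1)`-fold `f`-power of `a`
(`cpow f a 0 = a`, `cpow f a (m+1) = f a (cpow f a m)`). -/
def cpow {A : Type*} (f : A → A → A) (a : A) : ℕ → A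
  | 0 => a
  | m + 1 => f a (cpow f a m)

/-- `levels f i = A^{i+1}`: `A^1 = A` and `A^{i+1} = ⟨{f a x : x ∈ A^i}⟩`. -/
def levels {A : Type*} [AddCommGroup A] (f : A → A → A) : ℕ → AddSubgroup A
  | 0 => ⊤
  | i + 1 => AddSubgroup.closure {z : A | ∃ x : A, ∃ y ∈ levels f i, z = f x y}

/-- The binomial theorem for a truncated sequence of divided powers. -/
theorem sum_dividedPowers_mul {R : Type*} [Ring R] (f : ℕ → R) (K : ℕ)
    (hmul : ∀ i j, f i * f j = (i + j).choose i • f (i + j))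
    (hK : ∀ j, K ≤ j → f j = 0) (m m' : ℕ) :
    (∑ i ∈ Finset.range K, m ^ i • f i) * (∑ j ∈ Finset.range K, m' ^ j • f j)
      = ∑ k ∈ Finset.range K, (m + m') ^ k • f k := by
  have hterm : ∀ k, ∑ x ∈ Finset.HasAntidiagonal.antidiagonal k, (m ^ x.1 • f x.1) * (m' ^ x.2 • f x.2)
      = (m + m') ^ k • f k := by
    intro k
    rw [add_pow, Finset.sum_smul]
    refine Eq.trans ?_ (Finset.Nat.sum_antidiagonal_eq_sum_range_succ
      (fun i j => (m ^ i * m' ^ j * k.choose i) • f k) k)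
    refine Finset.sum_congr rfl fun x hx => ?_
    rw [Finset.HasAntidiagonal.mem_antidiagonal] at hx
    rw [smul_mul_smul_comm, hmul, hx, smul_smul]
  have hprod : ∀ x : ℕ × ℕ, x ∉ Finset.range K ×ˢ Finset.range K →
      (m ^ x.1 • f x.1) * (m' ^ x.2 • f x.2) = 0 := by
    intro x hx
    rw [Finset.mem_product, Finset.mem_range, Finset.mem_range, not_and_or, not_lt, not_lt] at hx
    rcases hx with h | h
    · rw [hK _ h, smul_zero, zero_mul]
    · rw [hK _ h, smul_zero, mul_zero]
  calc _ = ∑ x ∈ Finset.range K ×ˢ Finset.range K, (m ^ x.1 • f x.1) * (m' ^ x.2 • f x.2) := by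
        rw [Finset.sum_mul_sum, Finset.sum_product]
    _ = ∑ k ∈ Finset.range (2 * K), ∑ x ∈ Finset.range K ×ˢ Finset.range K with x.1 + x.2 = k,
          (m ^ x.1 • f x.1) * (m' ^ x.2 • f x.2) := by
        refine (Finset.sum_fiberwise_of_maps_to ?_ _).symm
        intro x hx
        simp only [Finset.mem_product, Finset.mem_range] at hx ⊢
        omega
    _ = ∑ k ∈ Finset.range (2 * K), (m + m') ^ k • f k := by
        refine Finset.sum_congr rfl fun k _ => ?_
        rw [← hterm]
        refine Finset.sum_subset ?_ ?_
        · intro x hx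
          rw [Finset.mem_filter] at hx
          exact Finset.HasAntidiagonal.mem_antidiagonal.2 hx.2
        · intro x hx hx'
          refine hprod x fun h => hx' (Finset.mem_filter.2 ⟨h, Finset.HasAntidiagonal.mem_antidiagonal.1 hx⟩)
    _ = _ := by
        refine (Finset.sum_subset (Finset.range_mono (by omega)) ?_).symm
        intro k _ hk
        rw [hK k (by simpa using hk), smul_zero]

/-- The `c`-th power of `L` is divisible by `p` and decreases the exponent of `p`-power torsion. -/
structure IsPowDivisible {M : Type*} [AddCommGroup M] (p c : ℕ) (L : AddMonoid.End M) : Prop where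
  exists_smul_eq : ∀ b : M, ∃ z : M, p • z = (L ^ c) b
  smul_pow_apply : ∀ (i : ℕ) (b : M), p ^ (i + 1) • b = 0 → p ^ i • (L ^ c) b = 0

namespace IsPowDivisible

variable {M : Type*} [AddCommGroup M] {p c : ℕ} {L : AddMonoid.End M}

theorem pow_apply_add (L : AddMonoid.End M) (i j : ℕ) (b : M) :
    (L ^ (i + j)) b = (L ^ i) ((L ^ j) b) := by
  rw [pow_add]; rfl

theorem exists_pow_smul_eq (h : IsPowDivisible p c L) (s : ℕ) (b : M) :
    ∃ z : M, p ^ s • z = (L ^ (c * s)) b := by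
  induction s with
  | zero => exact ⟨b, by simp⟩
  | succ s ih =>
    obtain ⟨z, hz⟩ := ih
    obtain ⟨w, hw⟩ := h.exists_smul_eq z
    refine ⟨w, ?_⟩
    rw [mul_add, mul_one, add_comm (c * s) c, pow_apply_add, ← hz, map_nsmul, ← hw, smul_smul,
      pow_succ]

theorem pow_apply_eq_zero (h : IsPowDivisible p c L) {s k : ℕ} (hk : c * s ≤ k) {b : M}
    (hb : p ^ s • b = 0) : (L ^ k) b = 0 := by
  obtain ⟨d, rfl⟩ := Nat.exists_eq_add_of_le' hk
  rw [pow_apply_add]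
  suffices (L ^ (c * s)) b = 0 by rw [this, map_zero]
  clear hk
  induction s generalizing b with
  | zero => simpa using hb
  | succ s ih =>
    rw [mul_add, mul_one, pow_apply_add]
    exact ih (h.smul_pow_apply s b hb)

theorem pow_apply_congr (h : IsPowDivisible p c L) {s k : ℕ} (hk : c * s ≤ k) {y z : M}
    (hyz : p ^ s • y = p ^ s • z) : (L ^ k) y = (L ^ k) z := by
  rw [← sub_eq_zero, ← map_sub]
  exact h.pow_apply_eq_zero hk (by rw [smul_sub, hyz, sub_self])

theorem exists_hom (h : IsPowDivisible p c L) {s k : ℕ} (hk : c * s ≤ k) :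
    ∃ E : AddMonoid.End M, ∀ b z : M, p ^ s • z = (L ^ (c * s)) b → E b = (L ^ k) z := by
  choose g hg using h.exists_pow_smul_eq s
  refine ⟨AddMonoidHom.mk' (fun b => (L ^ k) (g b)) fun a b => ?_, fun b z hz => ?_⟩
  · rw [← map_add]
    exact h.pow_apply_congr hk (by rw [smul_add, hg, hg, hg, map_add])
  · exact h.pow_apply_congr hk (by rw [hg, hz])

end IsPowDivisible

open Classical in
/-- The operator `p⁻ˢ • L ^ (c * s + k)`, when it makes sense. -/
noncomputable def divPow {M : Type*} [AddCommGroup M] (p c : ℕ) (L : AddMonoid.End M) (s k : ℕ) :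
    AddMonoid.End M :=
  if h : ∃ E : AddMonoid.End M, ∀ b z : M, p ^ s • z = (L ^ (c * s)) b → E b = (L ^ k) z
  then h.choose else 0

namespace IsPowDivisible

variable {M : Type*} [AddCommGroup M] {p c : ℕ} {L : AddMonoid.End M}

theorem divPow_apply (h : IsPowDivisible p c L) {s k : ℕ} (hk : c * s ≤ k) {b z : M}
    (hz : p ^ s • z = (L ^ (c * s)) b) : divPow p c L s k b = (L ^ k) z := by
  rw [divPow, dif_pos (h.exists_hom hk)]
  exact (h.exists_hom hk).choose_spec b z hz

theorem divPow_zero (h : IsPowDivisible p c L) (k : ℕ) : divPow p c L 0 k = L ^ k := by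
  ext b
  exact h.divPow_apply (by simp) (by simp)

theorem divPow_mul_divPow (h : IsPowDivisible p c L) {s k s' k' : ℕ} (hk : c * s ≤ k)
    (hk' : c * s' ≤ k') :
    divPow p c L s k * divPow p c L s' k' = divPow p c L (s + s') (k + k') := by
  ext b
  obtain ⟨z, hz⟩ := h.exists_pow_smul_eq s' b
  obtain ⟨w, hw⟩ := h.exists_pow_smul_eq s z
  change divPow p c L s k (divPow p c L s' k' b) = _
  rw [h.divPow_apply hk' hz,
    h.divPow_apply (z := (L ^ k') w) hk, h.divPow_apply (z := w), pow_apply_add]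
  · rw [mul_add]; omega
  · rw [mul_add, pow_apply_add, ← hz, map_nsmul, ← hw, smul_smul, pow_add, mul_comm]
  · rw [← map_nsmul, hw, ← pow_apply_add, ← pow_apply_add, add_comm]

theorem pow_smul_divPow (h : IsPowDivisible p c L) {s v k : ℕ} (hk : c * (s + v) ≤ k) :
    p ^ v • divPow p c L (s + v) k = divPow p c L s (k + c * v) := by
  ext b
  obtain ⟨z, hz⟩ := h.exists_pow_smul_eq s b
  obtain ⟨w, hw⟩ := h.exists_pow_smul_eq (s + v) b
  have hks : c * s ≤ k := le_trans (Nat.mul_le_mul_left _ (by omega)) hk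
  change p ^ v • divPow p c L (s + v) k b = _
  rw [h.divPow_apply hk hw, h.divPow_apply (by omega) hz,
    pow_apply_add, ← map_nsmul]
  refine h.pow_apply_congr hks ?_
  rw [← map_nsmul, hz, smul_smul, ← pow_add, hw, mul_add, ← pow_apply_add, add_comm]

theorem nsmul_left (h : IsPowDivisible p c L) (m : ℕ) : IsPowDivisible p c (m • L) where
  exists_smul_eq b := by
    obtain ⟨z, hz⟩ := h.exists_smul_eq b
    refine ⟨m ^ c • z, ?_⟩
    rw [smul_comm, hz, smul_pow]; rfl
  smul_pow_apply i b hb := by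
    rw [smul_pow]
    change p ^ i • (m ^ c • (L ^ c) b) = 0
    rw [smul_comm, h.smul_pow_apply i b hb, smul_zero]

theorem divPow_nsmul (h : IsPowDivisible p c L) (m : ℕ) {s k : ℕ} (hk : c * s ≤ k) :
    divPow p c (m • L) s k = m ^ (k + c * s) • divPow p c L s k := by
  ext b
  obtain ⟨z, hz⟩ := h.exists_pow_smul_eq s b
  rw [(h.nsmul_left m).divPow_apply (z := m ^ (c * s) • z) hk]
  · change _ = m ^ (k + c * s) • divPow p c L s k b
    rw [h.divPow_apply hk hz, smul_pow, pow_add, mul_smul, ← map_nsmul (L ^ k)]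
    rfl
  · rw [smul_comm, hz, smul_pow]; rfl

theorem pow_eq_zero (h : IsPowDivisible p c L) {n : ℕ} (hn : p ^ n • L = 0) {k : ℕ}
    (hk : c * n + 1 ≤ k) : L ^ k = 0 := by
  refine pow_eq_zero_of_le hk ?_
  ext b
  obtain ⟨z, hz⟩ := h.exists_pow_smul_eq n b
  rw [add_comm, pow_apply_add, pow_one, ← hz, map_nsmul]
  exact DFunLike.congr_fun hn z

theorem divPow_eq_zero (h : IsPowDivisible p c L) {n : ℕ} (hn : p ^ n • L = 0) {s k : ℕ}
    (hk : c * s ≤ k) (hk' : c * n + 1 ≤ k) : divPow p c L s k = 0 := by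
  ext b
  obtain ⟨z, hz⟩ := h.exists_pow_smul_eq s b
  rw [h.divPow_apply hk hz, h.pow_eq_zero hn hk']
  rfl

theorem pow_smul_divPow_eq_zero (h : IsPowDivisible p c L) {n : ℕ} (hn : p ^ n • L = 0) {s k : ℕ}
    (hk : c * s ≤ k) (hk' : 1 ≤ k) : p ^ n • divPow p c L s k = 0 := by
  ext b
  obtain ⟨z, hz⟩ := h.exists_pow_smul_eq s b
  change p ^ n • divPow p c L s k b = 0
  obtain ⟨k, rfl⟩ := Nat.exists_eq_add_of_le' hk'
  rw [h.divPow_apply hk hz, pow_apply_add, ← map_nsmul, pow_one]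
  have : p ^ n • L z = 0 := DFunLike.congr_fun hn z
  rw [this, map_zero]

end IsPowDivisible

namespace PreLieRing

theorem four_mul_sVal_le {p : ℕ} (hp : p.Prime) (j : ℕ) :
    4 * (((p - 1) / 4) * sVal p j) ≤ j := by
  have := Fact.mk hp
  have h := sub_one_mul_padicValNat_factorial (p := p) j
  have h1 : (p - 1) * sVal p j ≤ j := by
    rw [sVal, Nat.factorization_def _ hp, h]; omega
  calc 4 * (((p - 1) / 4) * sVal p j) = (4 * ((p - 1) / 4)) * sVal p j := by ring
    _ ≤ (p - 1) * sVal p j := Nat.mul_le_mul_right _ (by omega)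
    _ ≤ j := h1

theorem sVal_add_le (p i j : ℕ) : sVal p i + sVal p j ≤ sVal p (i + j) := by
  have h := (Nat.factorization_le_iff_dvd (mul_ne_zero i.factorial_ne_zero j.factorial_ne_zero)
    (i + j).factorial_ne_zero).2 (Nat.factorial_mul_factorial_dvd_factorial_add i j) p
  rwa [Nat.factorization_mul i.factorial_ne_zero j.factorial_ne_zero] at h

/-- The product formula for the inverses of the prime-to-`p` parts of factorials. -/
theorem modEq_choose_mul {p n : ℕ} (hp : p.Prime) (σ : ℕ → ℤ)
    (hσ : ∀ j, σ j * ((j.factorial / p ^ sVal p j : ℕ) : ℤ) ≡ 1 [ZMOD (p : ℤ) ^ n])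
    {i j v : ℕ} (hv : sVal p (i + j) = sVal p i + sVal p j + v) :
    σ i * σ j * (p : ℤ) ^ v ≡ (i + j).choose i * σ (i + j) [ZMOD (p : ℤ) ^ n] := by
  have key : ((i.factorial / p ^ sVal p i : ℕ) : ℤ) * (j.factorial / p ^ sVal p j : ℕ)
      * (i + j).choose i = ((i + j).factorial / p ^ sVal p (i + j) : ℕ) * (p : ℤ) ^ v := by
    have e : ∀ k : ℕ, p ^ sVal p k * (k.factorial / p ^ sVal p k) = k.factorial :=
      fun k => Nat.ordProj_mul_ordCompl_eq_self _ _
    have e1 := e i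
    have e2 := e j
    have e3 := e (i + j)
    have e4 : (i + j).choose i * i.factorial * j.factorial = (i + j).factorial := by
      rw [Nat.choose_symm_add]; exact Nat.add_choose_mul_factorial_mul_factorial i j
    generalize i.factorial / p ^ sVal p i = x at *
    generalize j.factorial / p ^ sVal p j = y at *
    generalize (i + j).factorial / p ^ sVal p (i + j) = z at *
    rw [← e1, ← e2, ← e3, hv] at e4
    have : 0 < p ^ (sVal p i + sVal p j) := pow_pos hp.pos _
    norm_cast
    refine Nat.eq_of_mul_eq_mul_left this ?_
    rw [pow_add] at e4 ⊢
    rw [pow_add] at e4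
    linarith
  have hi := hσ i
  have hj := hσ j
  have hij := hσ (i + j)
  generalize ((i.factorial / p ^ sVal p i : ℕ) : ℤ) = x at *
  generalize ((j.factorial / p ^ sVal p j : ℕ) : ℤ) = y at *
  generalize (((i + j).factorial / p ^ sVal p (i + j) : ℕ) : ℤ) = z at *
  calc σ i * σ j * (p : ℤ) ^ v = σ i * σ j * (p : ℤ) ^ v * 1 := by ring
    _ ≡ σ i * σ j * (p : ℤ) ^ v * (σ (i + j) * z) [ZMOD (p : ℤ) ^ n] := hij.symm.mul_left _
    _ = ((σ i * x) * (σ j * y)) * ((i + j).choose i * σ (i + j)) := by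
      linear_combination -(σ i * σ j * σ (i + j)) * key
    _ ≡ (1 * 1) * ((i + j).choose i * σ (i + j)) [ZMOD (p : ℤ) ^ n] := (hi.mul hj).mul_right _
    _ = _ := by ring

end PreLieRing

namespace IsPowDivisible

variable {M : Type*} [AddCommGroup M] {p n : ℕ} {L : AddMonoid.End M}

theorem divPow_sVal_mul (hp : p.Prime) (h : IsPowDivisible p ((p - 1) / 4) L)
    (hn : p ^ n • L = 0) (σ : ℕ → ℤ) (hσ0 : σ 0 = 1)
    (hσ : ∀ j, σ j * ((j.factorial / p ^ sVal p j : ℕ) : ℤ) ≡ 1 [ZMOD (p : ℤ) ^ n]) (i j : ℕ) :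
    (σ i • divPow p ((p - 1) / 4) L (sVal p i) (i - etaVal p i))
      * (σ j • divPow p ((p - 1) / 4) L (sVal p j) (j - etaVal p j))
    = (i + j).choose i •
      (σ (i + j) • divPow p ((p - 1) / 4) L (sVal p (i + j)) (i + j - etaVal p (i + j))) := by
  obtain ⟨v, hv⟩ := Nat.exists_eq_add_of_le (sVal_add_le p i j)
  have bi := four_mul_sVal_le hp i
  have bj := four_mul_sVal_le hp j
  have bij := four_mul_sVal_le hp (i + j)
  have hmod := modEq_choose_mul hp σ hσ hv
  unfold etaVal
  rw [smul_mul_smul_comm, h.divPow_mul_divPow (by omega) (by omega)]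
  generalize (p - 1) / 4 = c at *
  have hcv : c * sVal p (i + j) = c * sVal p i + c * sVal p j + c * v := by rw [hv]; ring
  have e : i - c * sVal p i + (j - c * sVal p j) = i + j - c * sVal p (i + j) + c * v := by omega
  rw [e, ← h.pow_smul_divPow (by rw [← hv]; omega), ← hv, ← natCast_zsmul, ← natCast_zsmul,
    smul_smul, smul_smul]
  rcases Nat.eq_zero_or_pos (i + j) with h0 | h0
  · obtain ⟨rfl, rfl⟩ : i = 0 ∧ j = 0 := by omega
    have : v = 0 := by simpa [sVal] using hv.symm
    simp [hσ0, this]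
  · obtain ⟨d, hd⟩ := hmod.symm.dvd
    have hkill := h.pow_smul_divPow_eq_zero hn
      (s := sVal p (i + j)) (k := i + j - c * sVal p (i + j)) (by omega) (by omega)
    rw [← sub_eq_zero, ← sub_smul]
    push_cast
    rw [hd, mul_comm, mul_smul]
    have : ((p : ℤ) ^ n) • divPow p c L (sVal p (i + j)) (i + j - c * sVal p (i + j)) = 0 := by
      rw [← hkill, ← natCast_zsmul]; push_cast; rfl
    rw [this, zsmul_zero]

end IsPowDivisible

namespace PreLieRing

variable {A : Type*} [PreLieRing A]

/-- Left multiplication by `x` as an additive map. -/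
def mulLeft (x : A) : A →+ A := AddMonoidHom.mk' (mul x) (mul_add' x)

/-- Right multiplication by `y` as an additive map. -/
def mulRight (y : A) : A →+ A := AddMonoidHom.mk' (fun x => mul x y) fun a b => add_mul' a b y

/-- Left multiplication by `x` on `A` with a unit adjoined, composed with the projection. -/
def leftExt (x : A) : AddMonoid.End (A × ℤ) :=
  AddMonoidHom.mk' (fun v => (mul x v.1 + v.2 • x, 0)) fun a b => by
    simp only [Prod.fst_add, Prod.snd_add, mul_add', add_smul, Prod.mk_add_mk, add_zero]
    rw [add_add_add_comm]

theorem leftExt_apply (x : A) (v : A × ℤ) : leftExt x v = (mul x v.1 + v.2 • x, 0) := rfl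

theorem leftExt_nsmul (m : ℕ) (x : A) : leftExt (m • x) = m • leftExt x := by
  refine DFunLike.ext _ _ fun v => ?_
  change leftExt (m • x) v = m • leftExt x v
  rw [leftExt_apply, leftExt_apply, Prod.smul_mk, smul_add, smul_zero, smul_comm m v.2 x]
  congr 2
  exact map_nsmul (mulRight v.1) m x

theorem Lpow_succ (x : A) (m : ℕ) (b : A) : Lpow x (m + 1) b = mul x (Lpow x m b) :=
  Function.iterate_succ_apply' _ _ _

theorem leftExt_pow_apply (x : A) (m : ℕ) (b : A) : (leftExt x ^ m) (b, 0) = (Lpow x m b, 0) := by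
  induction m with
  | zero => simp [Lpow]
  | succ m ih =>
    rw [add_comm m 1, IsPowDivisible.pow_apply_add, ih, pow_one, leftExt_apply, add_comm 1 m,
      Lpow_succ]
    simp

theorem leftExt_pow_succ_apply (x : A) (m : ℕ) (v : A × ℤ) :
    (leftExt x ^ (m + 1)) v = (Lpow x m (mul x v.1 + v.2 • x), 0) := by
  rw [IsPowDivisible.pow_apply_add, pow_one, leftExt_apply, leftExt_pow_apply]

theorem nestedMul_replicate (x : A) (m : ℕ) (b : A) :
    nestedMul (List.replicate m x) b = Lpow x m b := by
  induction m with
  | zero => rfl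
  | succ m ih => rw [List.replicate_succ, nestedMul, ih, Lpow_succ]

theorem isPowDivisible_leftExt {p : ℕ} (hp5 : 5 ≤ p) (h : Property3 p A) (x : A) :
    IsPowDivisible p ((p - 1) / 4) (leftExt x) := by
  obtain ⟨c, hc⟩ : ∃ c, (p - 1) / 4 = c + 1 := ⟨(p - 1) / 4 - 1, by omega⟩
  obtain ⟨h1, h2⟩ := h
  rw [hc] at *
  constructor
  · intro v
    obtain ⟨z, hz⟩ := h1 (List.replicate c x) (mul x v.1 + v.2 • x) (by simp)
    refine ⟨(z, 0), ?_⟩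
    rw [leftExt_pow_succ_apply, ← nestedMul_replicate, ← hz]
    simp
  · rintro i ⟨b, m⟩ hb
    have hb1 : p ^ (i + 1) • b = 0 := congrArg Prod.fst hb
    have hb2 : p ^ (i + 1) • m = 0 := congrArg Prod.snd hb
    obtain rfl : m = 0 := by
      refine (smul_eq_zero.1 hb2).resolve_left (pow_ne_zero _ (by omega))
    obtain ⟨y, hy, hxy⟩ := h2 (i + 1) (by omega) (List.replicate (c + 1) x) (by simp) b hb1
    rw [leftExt_pow_apply, ← nestedMul_replicate, hxy, Prod.smul_mk, smul_smul, ← pow_succ,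
      smul_zero]
    exact congrArg (fun t => (t, (0 : ℤ))) hy

theorem pow_smul_iterate {p : ℕ} {ρ : A → A} (hρ1 : ∀ x : A, x ∈ pA p 1 → p • ρ x = x)
    (hρ2 : ∀ i : ℕ, 1 ≤ i → ∀ x : A, x ∈ pA p i → ρ x ∈ pA p (i - 1)) (s : ℕ) (y : A)
    (hy : y ∈ pA p s) : p ^ s • ρ^[s] y = y := by
  induction s generalizing y with
  | zero => simp
  | succ s ih =>
    have h1 : y ∈ pA p 1 := by
      obtain ⟨z, rfl⟩ := hy
      exact ⟨p ^ s • z, by simp only [smul_smul, pow_succ', pow_zero, mul_one]⟩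
    rw [Function.iterate_succ_apply, pow_succ', mul_smul, ih _ (hρ2 (s + 1) (by omega) y hy),
      hρ1 y h1]

section operators

variable {p : ℕ} {ρ : A → A}

theorem divPow_leftExt_inl (hp : p.Prime) (hp5 : 5 ≤ p) (h : Property3 p A)
    (hρ1 : ∀ x : A, x ∈ pA p 1 → p • ρ x = x)
    (hρ2 : ∀ i : ℕ, 1 ≤ i → ∀ x : A, x ∈ pA p i → ρ x ∈ pA p (i - 1))
    (x b : A) {j : ℕ} (hj : 1 ≤ j) :
    divPow p ((p - 1) / 4) (leftExt x) (sVal p j) (j - etaVal p j) (b, 0)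
      = (Eop p ρ x j b, 0) := by
  have hL := isPowDivisible_leftExt hp5 h x
  have hb := four_mul_sVal_le hp j
  have hmem : Lpow x (etaVal p j) b ∈ pA p (sVal p j) := by
    obtain ⟨z, hz⟩ := hL.exists_pow_smul_eq (sVal p j) (b, 0)
    rw [leftExt_pow_apply] at hz
    exact ⟨z.1, congrArg Prod.fst hz⟩
  rw [Eop, if_neg (by omega), ← leftExt_pow_apply]
  refine hL.divPow_apply (by unfold etaVal; omega) ?_
  rw [leftExt_pow_apply, Prod.smul_mk, smul_zero, pow_smul_iterate hρ1 hρ2 _ _ hmem, etaVal]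

theorem divPow_leftExt_inr (hp : p.Prime) (hp5 : 5 ≤ p) (h : Property3 p A)
    (hρ1 : ∀ x : A, x ∈ pA p 1 → p • ρ x = x)
    (hρ2 : ∀ i : ℕ, 1 ≤ i → ∀ x : A, x ∈ pA p i → ρ x ∈ pA p (i - 1))
    (x : A) {j : ℕ} (hj : 1 ≤ j) :
    divPow p ((p - 1) / 4) (leftExt x) (sVal p j) (j - etaVal p j) (0, 1)
      = (Ediag p ρ x j, 0) := by
  have hL := isPowDivisible_leftExt hp5 h x
  have hb := four_mul_sVal_le hp j
  have hunit : ∀ m : ℕ, 1 ≤ m → (leftExt x ^ m) (0, 1) = (Lpow x (m - 1) x, 0) := by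
    intro m hm
    obtain ⟨m, rfl⟩ := Nat.exists_eq_add_of_le' hm
    rw [leftExt_pow_succ_apply]
    have : mul x (0 : A) = 0 := map_zero (mulLeft x)
    simp [this]
  rw [Ediag, if_neg (by omega)]
  split_ifs with h0
  · have hs : sVal p j = 0 := (mul_eq_zero.1 h0).resolve_left (by omega)
    rw [hs, h0, hL.divPow_zero, Nat.sub_zero, hunit j hj]
  · have hmem : Lpow x (etaVal p j - 1) x ∈ pA p (sVal p j) := by
      obtain ⟨z, hz⟩ := hL.exists_pow_smul_eq (sVal p j) (0, 1)
      rw [hunit _ (by unfold etaVal at h0; omega)] at hz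
      exact ⟨z.1, congrArg Prod.fst hz⟩
    rw [← leftExt_pow_apply]
    refine hL.divPow_apply (by unfold etaVal; omega) ?_
    rw [hunit _ (by unfold etaVal at h0; omega), Prod.smul_mk, smul_zero,
      pow_smul_iterate hρ1 hρ2 _ _ hmem, etaVal]

end operators

/-- The truncated exponential of `leftExt x`, with divided powers in place of `L ^ j / j!`. -/
noncomputable def expOp (p K : ℕ) (σ : ℕ → ℤ) (x : A) : AddMonoid.End (A × ℤ) :=
  ∑ j ∈ Finset.range K,
    σ j • divPow p ((p - 1) / 4) (leftExt x) (sVal p j) (j - etaVal p j)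

theorem pow_smul_leftExt {p n : ℕ} (hA : ∀ a : A, p ^ n • a = 0) (x : A) :
    p ^ n • leftExt x = 0 := by
  refine DFunLike.ext _ _ fun v => ?_
  change p ^ n • leftExt x v = 0
  rw [leftExt_apply, Prod.smul_mk, hA, smul_zero]
  rfl

theorem divPow_leftExt_eq_zero {p n : ℕ} (hp : p.Prime) (hp5 : 5 ≤ p) (h : Property3 p A)
    (hA : ∀ a : A, p ^ n • a = 0) (x : A) {j : ℕ} (hj : 2 * ((p - 1) / 4 * n + 1) ≤ j) :
    divPow p ((p - 1) / 4) (leftExt x) (sVal p j) (j - etaVal p j) = 0 := by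
  have hb := four_mul_sVal_le hp j
  unfold etaVal
  exact (isPowDivisible_leftExt hp5 h x).divPow_eq_zero (pow_smul_leftExt hA x)
    (by omega) (by omega)

theorem expOp_nsmul_mul {p n : ℕ} (hp : p.Prime) (hp5 : 5 ≤ p) (h : Property3 p A)
    (hA : ∀ a : A, p ^ n • a = 0) (σ : ℕ → ℤ) (hσ0 : σ 0 = 1)
    (hσ : ∀ j, σ j * ((j.factorial / p ^ sVal p j : ℕ) : ℤ) ≡ 1 [ZMOD (p : ℤ) ^ n])
    {K : ℕ} (hK : 2 * ((p - 1) / 4 * n + 1) ≤ K) (x : A) (m m' : ℕ) :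
    expOp p K σ (m • x) * expOp p K σ (m' • x) = expOp p K σ ((m + m') • x) := by
  have hL := isPowDivisible_leftExt hp5 h x
  have hexp : ∀ m : ℕ, expOp p K σ (m • x) = ∑ j ∈ Finset.range K, m ^ j •
      (σ j • divPow p ((p - 1) / 4) (leftExt x) (sVal p j) (j - etaVal p j)) := by
    intro m
    refine Finset.sum_congr rfl fun j _ => ?_
    have hb := four_mul_sVal_le hp j
    unfold etaVal
    rw [leftExt_nsmul, hL.divPow_nsmul m (by omega), Nat.sub_add_cancel (by omega), smul_comm]
  rw [hexp, hexp, hexp]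
  refine sum_dividedPowers_mul _ K
    (hL.divPow_sVal_mul hp (pow_smul_leftExt hA x) σ hσ0 hσ) (fun j hj => ?_) m m'
  rw [divPow_leftExt_eq_zero hp hp5 h hA x (hK.trans hj), zsmul_zero]

theorem expOp_apply {p n : ℕ} (hp : p.Prime) (hp5 : 5 ≤ p) (h : Property3 p A)
    (hA : ∀ a : A, p ^ n • a = 0) {ρ : A → A} (hρ1 : ∀ x : A, x ∈ pA p 1 → p • ρ x = x)
    (hρ2 : ∀ i : ℕ, 1 ≤ i → ∀ x : A, x ∈ pA p i → ρ x ∈ pA p (i - 1))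
    (σ σ' : ℕ → ℤ) (hσ0 : σ' 0 = 1) (hσ : ∀ j, 1 ≤ j → σ' j = σ j)
    {K : ℕ} (hK : 2 * ((p - 1) / 4 * n + 1) ≤ K) (x b : A) (m : ℤ) :
    expOp p K σ' x (b, m) = (b + m • Wmap p σ ρ x + Wop p σ ρ x b, m) := by
  have hdec : ((b, m) : A × ℤ) = (b, 0) + m • (0, 1) := by simp
  have hop : Wop p σ ρ x b = ∑ j ∈ Finset.range K, σ j • Eop p ρ x j b := by
    refine finsum_eq_sum_of_support_subset _ fun j hj => ?_
    rw [Finset.coe_range, Set.mem_Iio]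
    by_contra! hjK
    refine hj ?_
    have := divPow_leftExt_inl hp hp5 h hρ1 hρ2 x b (j := j) (by omega)
    rw [divPow_leftExt_eq_zero hp hp5 h hA x (hK.trans hjK)] at this
    have hE : Eop p ρ x j b = 0 := (congrArg Prod.fst this).symm
    change σ j • Eop p ρ x j b = 0
    rw [hE, smul_zero]
  have hdiag : Wmap p σ ρ x = ∑ j ∈ Finset.range K, σ j • Ediag p ρ x j := by
    refine finsum_eq_sum_of_support_subset _ fun j hj => ?_
    rw [Finset.coe_range, Set.mem_Iio]
    by_contra! hjK
    refine hj ?_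
    have := divPow_leftExt_inr hp hp5 h hρ1 hρ2 x (j := j) (by omega)
    rw [divPow_leftExt_eq_zero hp hp5 h hA x (hK.trans hjK)] at this
    have hE : Ediag p ρ x j = 0 := (congrArg Prod.fst this).symm
    change σ j • Ediag p ρ x j = 0
    rw [hE, smul_zero]
  obtain ⟨K, rfl⟩ : ∃ k, K = k + 1 := ⟨K - 1, by omega⟩
  have happ : expOp p (K + 1) σ' x (b, m) = ∑ j ∈ Finset.range (K + 1),
      σ' j • divPow p ((p - 1) / 4) (leftExt x) (sVal p j) (j - etaVal p j) (b, m) := by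
    rw [expOp]
    exact AddMonoidHom.finsetSum_apply _ _ _
  have hzero : divPow p ((p - 1) / 4) (leftExt x) (sVal p 0) (0 - etaVal p 0) = 1 := by
    have : sVal p 0 = 0 := by simp [sVal]
    rw [this, (isPowDivisible_leftExt hp5 h x).divPow_zero, Nat.zero_sub, pow_zero]
  rw [happ, Finset.sum_range_succ', hzero, hσ0, hop, hdiag, Finset.sum_range_succ',
    Finset.sum_range_succ']
  have hterm : ∀ j ∈ Finset.range K, σ' (j + 1) • divPow p ((p - 1) / 4) (leftExt x)
      (sVal p (j + 1)) (j + 1 - etaVal p (j + 1)) (b, m)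
      = (AddMonoidHom.inl A ℤ) (m • (σ (j + 1) • Ediag p ρ x (j + 1))
        + σ (j + 1) • Eop p ρ x (j + 1) b) := by
    intro j _
    rw [hdec, map_add, map_zsmul, divPow_leftExt_inl hp hp5 h hρ1 hρ2 x b (by omega),
      divPow_leftExt_inr hp hp5 h hρ1 hρ2 x (by omega), hσ _ (by omega)]
    simp [smul_add, smul_comm m, add_comm]
  rw [Finset.sum_congr rfl hterm, ← map_sum, Finset.sum_add_distrib, ← Finset.smul_sum]
  simp [Eop, Ediag]
  abel

/-- The subgroup spanned by the products `a₁ · (⋯ · (aₖ · b)⋯)`. -/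
def leftPower (A : Type*) [PreLieRing A] (k : ℕ) : AddSubgroup A :=
  AddSubgroup.closure {z : A | ∃ (l : List A) (b : A), l.length = k ∧ z = nestedMul l b}

theorem nestedMul_append (l l' : List A) (b : A) :
    nestedMul (l ++ l') b = nestedMul l (nestedMul l' b) := by
  induction l with
  | nil => rfl
  | cons a l ih => rw [List.cons_append, nestedMul, ih, nestedMul]

theorem nestedMul_nsmul (l : List A) (m : ℕ) (b : A) :
    nestedMul l (m • b) = m • nestedMul l b := by
  induction l with
  | nil => rfl
  | cons a l ih => rw [nestedMul, ih, nestedMul]; exact map_nsmul (mulLeft a) m _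

theorem nestedMul_mem_leftPower (l : List A) (b : A) : nestedMul l b ∈ leftPower A l.length :=
  AddSubgroup.subset_closure ⟨l, b, rfl, rfl⟩

theorem leftPower_zero : leftPower A 0 = ⊤ :=
  eq_top_iff.2 fun b _ => nestedMul_mem_leftPower [] b

theorem mul_mem_leftPower (x : A) {k : ℕ} {y : A} (hy : y ∈ leftPower A k) :
    mul x y ∈ leftPower A (k + 1) := by
  have : leftPower A k ≤ (leftPower A (k + 1)).comap (mulLeft x) := by
    refine (AddSubgroup.closure_le _).2 ?_
    rintro _ ⟨l, b, rfl, rfl⟩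
    exact nestedMul_mem_leftPower (x :: l) b
  exact this hy

theorem Lpow_mem_leftPower (x : A) {k : ℕ} {y : A} (hy : y ∈ leftPower A k) (m : ℕ) :
    Lpow x m y ∈ leftPower A (k + m) := by
  induction m with
  | zero => exact hy
  | succ m ih => rw [Lpow_succ]; exact mul_mem_leftPower x ih

theorem leftPower_antitone : Antitone (leftPower A) := by
  refine antitone_nat_of_succ_le fun k => (AddSubgroup.closure_le _).2 ?_
  rintro _ ⟨l, b, hl, rfl⟩
  obtain ⟨l, a, rfl⟩ : ∃ l' a, l = l' ++ [a] := by
    rcases List.eq_nil_or_concat l with rfl | h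
    · simp at hl
    · simpa using h
  rw [nestedMul_append]
  have : l.length = k := by simpa using hl
  exact this ▸ nestedMul_mem_leftPower l _

theorem leftPower_add_le {p : ℕ} (hp5 : 5 ≤ p) (h : Property3 p A) (k s : ℕ) {y : A}
    (hy : y ∈ leftPower A (k + (p - 1) / 4 * s)) : ∃ z ∈ leftPower A k, p ^ s • z = y := by
  induction s generalizing y with
  | zero => exact ⟨y, hy, by simp⟩
  | succ s ih =>
    have hle : leftPower A (k + (p - 1) / 4 * (s + 1)) ≤
        (leftPower A (k + (p - 1) / 4 * s)).map (nsmulAddMonoidHom p) := by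
      refine (AddSubgroup.closure_le _).2 ?_
      rintro _ ⟨l, b, hl, rfl⟩
      rw [mul_add, mul_one, ← add_assoc] at hl
      have h1 : (l.take (k + (p - 1) / 4 * s)).length = k + (p - 1) / 4 * s := by
        rw [List.length_take]; omega
      have h2 : (l.drop (k + (p - 1) / 4 * s)).length = (p - 1) / 4 := by
        rw [List.length_drop]; omega
      rw [← List.take_append_drop (k + (p - 1) / 4 * s) l, nestedMul_append]
      generalize l.take (k + (p - 1) / 4 * s) = l1 at *
      generalize l.drop (k + (p - 1) / 4 * s) = l2 at *
      obtain ⟨l2, a, rfl⟩ : ∃ l' a, l2 = l' ++ [a] := by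
        rcases List.eq_nil_or_concat l2 with rfl | h'
        · simp at h2; omega
        · simpa using h'
      obtain ⟨z, hz⟩ := h.1 l2 (mul a b) (by simpa using h2)
      refine ⟨nestedMul l1 z, h1 ▸ nestedMul_mem_leftPower l1 z, ?_⟩
      rw [nestedMul_append]
      change p • nestedMul l1 z = nestedMul l1 (nestedMul l2 (mul a b))
      rw [← hz, ← nestedMul_nsmul]
      simp
    obtain ⟨w, hw, rfl⟩ := hle hy
    obtain ⟨z, hz, rfl⟩ := ih hw
    exact ⟨z, hz, by rw [pow_succ', mul_smul]; rfl⟩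

theorem leftPower_eq_bot {p n : ℕ} [Finite A] (hp : p.Prime) (hp5 : 5 ≤ p)
    (h : Property3 p A) (hcard : Nat.card A = p ^ n) : leftPower A n = ⊥ := by
  have hA : ∀ a : A, p ^ n • a = 0 := fun a => hcard ▸ card_nsmul_eq_zero'
  have hbot : leftPower A ((p - 1) / 4 * n) = ⊥ := by
    refine (AddSubgroup.eq_bot_iff_forall _).2 fun y hy => ?_
    obtain ⟨z, -, rfl⟩ := leftPower_add_le hp5 h 0 n (by rwa [zero_add])
    exact hA z
  have hstab : ∀ k, leftPower A (k + 1) = leftPower A k → leftPower A k = ⊥ := by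
    intro k hk
    have hall : ∀ d, leftPower A k ≤ leftPower A (k + d) := by
      intro d
      induction d with
      | zero => exact le_rfl
      | succ d ih =>
        rw [← hk]
        refine (AddSubgroup.closure_le _).2 ?_
        rintro _ ⟨l, b, hl, rfl⟩
        obtain ⟨a, l, rfl⟩ := List.exists_cons_of_length_eq_add_one hl
        have : l.length = k := by simpa using hl
        exact mul_mem_leftPower a (ih (this ▸ nestedMul_mem_leftPower l b))
    refine eq_bot_iff.2 ((hall ((p - 1) / 4 * n)).trans ?_)
    rw [← hbot]
    exact leftPower_antitone (by omega)
  have hdesc : ∀ k, leftPower A k = ⊥ ∨ p ^ k * Nat.card (leftPower A k) ≤ p ^ n := by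
    intro k
    induction k with
    | zero =>
      right
      rw [leftPower_zero, AddSubgroup.card_top, hcard, pow_zero, one_mul]
    | succ k ih =>
      have hle : leftPower A (k + 1) ≤ leftPower A k := leftPower_antitone (by omega)
      by_cases heq : leftPower A (k + 1) = leftPower A k
      · left; rw [heq]; exact hstab k heq
      rcases ih with ih | ih
      · left; exact eq_bot_iff.2 (ih ▸ hle)
      right
      refine le_trans ?_ ih
      rw [pow_succ, mul_assoc]
      refine Nat.mul_le_mul_left _ ?_
      obtain ⟨r, -, hr⟩ := (Nat.dvd_prime_pow hp).1
        (hcard ▸ AddSubgroup.card_addSubgroup_dvd_card (leftPower A k))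
      obtain ⟨r', -, hr'⟩ := (Nat.dvd_prime_pow hp).1
        (hcard ▸ AddSubgroup.card_addSubgroup_dvd_card (leftPower A (k + 1)))
      have hlt : Nat.card (leftPower A (k + 1)) < Nat.card (leftPower A k) := by
        refine lt_of_le_of_ne (AddSubgroup.card_le_of_le hle) fun hc => heq ?_
        exact AddSubgroup.eq_of_le_of_card_ge hle hc.ge
      rw [hr, hr'] at hlt ⊢
      rw [← pow_succ']
      exact Nat.pow_le_pow_right hp.pos ((Nat.pow_lt_pow_iff_right hp.one_lt).1 hlt)
  rcases hdesc n with h' | h'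
  · exact h'
  · refine AddSubgroup.eq_bot_of_card_le _ ?_
    have := pow_pos hp.pos n
    exact Nat.le_of_mul_le_mul_left (by simpa using h') this

theorem Wop_mem_leftPower {p : ℕ} (hp : p.Prime) (hp5 : 5 ≤ p) (h : Property3 p A)
    {ρ : A → A} (hρ1 : ∀ x : A, x ∈ pA p 1 → p • ρ x = x)
    (hρ2 : ∀ i : ℕ, 1 ≤ i → ∀ x : A, x ∈ pA p i → ρ x ∈ pA p (i - 1))
    (σ : ℕ → ℤ) (x : A) {k : ℕ} {y : A} (hy : y ∈ leftPower A k) :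
    Wop p σ ρ x y ∈ leftPower A (k + 1) := by
  have hE : ∀ j, Eop p ρ x j y ∈ leftPower A (k + 1) := by
    intro j
    rcases Nat.eq_zero_or_pos j with rfl | hj
    · rw [Eop, if_pos rfl]; exact zero_mem _
    have hb := four_mul_sVal_le hp j
    obtain ⟨z, hz, hz'⟩ := leftPower_add_le hp5 h k (sVal p j)
      (Lpow_mem_leftPower x hy ((p - 1) / 4 * sVal p j))
    have h1 := divPow_leftExt_inl hp hp5 h hρ1 hρ2 x y hj
    rw [(isPowDivisible_leftExt hp5 h x).divPow_apply (z := (z, 0)) (by unfold etaVal; omega)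
      (by rw [leftExt_pow_apply, ← hz', Prod.smul_mk, smul_zero]), leftExt_pow_apply] at h1
    have h2 : Lpow x (j - etaVal p j) z = Eop p ρ x j y := congrArg Prod.fst h1
    rw [← h2]
    exact leftPower_antitone (by unfold etaVal; omega) (Lpow_mem_leftPower x hz _)
  exact finsum_induction (· ∈ leftPower A (k + 1)) (zero_mem _) (fun _ _ => add_mem)
    fun j => zsmul_mem (hE j) _

end PreLieRing

theorem statement18 {A : Type*} [PreLieRing A] [Fintype A] (p n : ℕ) (hp : p.Prime)
    (hp3 : 3 < p) (hcard : Fintype.card A = p ^ n) (hP3 : Property3 p A)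
    (ρ : A → A) (hρ1 : ∀ x : A, x ∈ pA p 1 → p • ρ x = x)
    (hρ2 : ∀ i : ℕ, 1 ≤ i → ∀ x : A, x ∈ pA p i → ρ x ∈ pA p (i - 1))
    (σ : ℕ → ℤ)
    (hσ : ∀ j : ℕ, 1 ≤ j →
      (p : ℤ) ^ n ∣ σ j * ((Nat.factorial j / p ^ sVal p j : ℕ) : ℤ) - 1)
    (Ω : A → A)
    (hΩ : ∀ a : A, Wmap p σ ρ (Ω a) = a ∧ Ω (Wmap p σ ρ a) = a)
    -- `a ∘' b = a + b + W(Ω(a), b)` and `a *' b = W(Ω(a), b)`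
    (circ' star' : A → A → A)
    (hcirc' : ∀ a b : A, circ' a b = a + b + Wop p σ ρ (Ω a) b)
    (hstar' : ∀ a b : A, star' a b = Wop p σ ρ (Ω a) b) :
    -- (1) every element has a right `∘'`-inverse
    (∀ a : A, ∃ a' : A, circ' a a' = 0) ∧
    -- (2) left distributivity of `*'`
    (∀ a b c : A, star' a (b + c) = star' a b + star' a c) ∧
    -- (3) `A^{n+1} = 0` for the left-nilpotent series built from `*'`
    (levels star' n = ⊥) ∧
    -- (4) the `∘'`-powers behave as powers,
    -- where `cpow circ' a i` denotes `a^{∘'(i+1)}`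
    (∀ (i j : ℕ) (a b : A),
      circ' (cpow circ' a i) (cpow circ' a j) = cpow circ' a (i + j + 1) ∧
      circ' (circ' (cpow circ' a i) (cpow circ' a j)) b
        = circ' (cpow circ' a (i + j + 1)) b ∧
      circ' (cpow circ' a i) b = (fun y => circ' a y)^[i + 1] b) := by
  have hp5 : 5 ≤ p := by
    have : p ≠ 4 := fun h => absurd (h ▸ hp) (by norm_num)
    omega
  have hcard' : Nat.card A = p ^ n := by rw [Nat.card_eq_fintype_card, hcard]
  have hA : ∀ a : A, p ^ n • a = 0 := fun a => hcard' ▸ card_nsmul_eq_zero'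
  obtain ⟨σ', hσ'⟩ : ∃ σ' : ℕ → ℤ, σ' = fun j => if j = 0 then 1 else σ j := ⟨_, rfl⟩
  have hσ0 : σ' 0 = 1 := by simp [hσ']
  have hσ1 : ∀ j, 1 ≤ j → σ' j = σ j := fun j hj => by
    rw [hσ']; exact if_neg (by omega)
  have hσmod : ∀ j, σ' j * ((j.factorial / p ^ sVal p j : ℕ) : ℤ) ≡ 1 [ZMOD (p : ℤ) ^ n] := by
    intro j
    rcases Nat.eq_zero_or_pos j with rfl | hj
    · simp [hσ0, sVal]
    · rw [hσ1 j hj]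
      exact (Int.modEq_iff_dvd.2 (hσ j hj)).symm
  have happ := fun x b m => expOp_apply hp hp5 hP3 hA hρ1 hρ2 σ σ' hσ0 hσ1 le_rfl x b m
  have hmul := fun x m m' => expOp_nsmul_mul hp hp5 hP3 hA σ' hσ0 hσmod le_rfl x m m'
  have hmem := fun x k y => Wop_mem_leftPower (k := k) (y := y) hp hp5 hP3 hρ1 hρ2 σ x
  have hbot := leftPower_eq_bot hp hp5 hP3 hcard'
  have hadd : ∀ x b b', Wop p σ ρ x (b + b') = Wop p σ ρ x b + Wop p σ ρ x b' := by
    intro x b b'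
    have h1 := map_add (expOp p (2 * ((p - 1) / 4 * n + 1)) σ' x) (b, 0) (b', 0)
    rw [Prod.mk_add_mk, add_zero, happ, happ, happ] at h1
    have h2 := congrArg Prod.fst h1
    simp only [zero_smul, add_zero, Prod.mk_add_mk] at h2
    rw [add_add_add_comm] at h2
    exact add_left_cancel h2
  obtain ⟨U, hU⟩ : ∃ U : A → A → A, U = fun x b => Wmap p σ ρ x + b + Wop p σ ρ x b := ⟨_, rfl⟩
  have hcirc : ∀ a b, circ' a b = U (Ω a) b := by
    intro a b
    rw [hcirc', hU]
    change _ = Wmap p σ ρ (Ω a) + b + Wop p σ ρ (Ω a) b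
    rw [(hΩ a).1]
  have hexpU : ∀ x b, expOp p (2 * ((p - 1) / 4 * n + 1)) σ' x (b, 1) = (U x b, 1) := by
    intro x b
    rw [happ, hU, one_smul, add_comm b]
  have hUiter : ∀ x (m : ℕ) b, U ((m + 1) • x) b = (U x)^[m + 1] b := by
    intro x m
    induction m with
    | zero => intro b; simp
    | succ m ih =>
      intro b
      rw [Function.iterate_succ_apply, ← ih]
      have h1 := DFunLike.congr_fun (hmul x (m + 1) 1) (b, 1)
      rw [one_smul] at h1
      change expOp _ _ _ _ (expOp _ _ _ _ _) = _ at h1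
      rw [hexpU, hexpU, hexpU] at h1
      exact (congrArg Prod.fst h1).symm
  have hWop0 : ∀ x, Wop p σ ρ x 0 = 0 := fun x => by simpa using hadd x 0 0
  have hU0 : ∀ x, U x 0 = Wmap p σ ρ x := fun x => by simp [hU, hWop0]
  have hcpow : ∀ a i, cpow circ' a i = (U (Ω a))^[i + 1] 0 := by
    intro a i
    induction i with
    | zero => rw [cpow, zero_add, Function.iterate_one, hU0, (hΩ a).1]
    | succ i ih => rw [cpow, hcirc, ih, Function.iterate_succ_apply' _ (i + 1)]
  have hpow : ∀ a i b, circ' (cpow circ' a i) b = (U (Ω a))^[i + 1] b := by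
    intro a i b
    rw [hcirc, hcpow, ← hUiter, hU0, (hΩ _).2, hUiter]
  have hadd4 : ∀ a i j,
      circ' (cpow circ' a i) (cpow circ' a j) = cpow circ' a (i + j + 1) := by
    intro a i j
    rw [hpow, hcpow, hcpow, ← Function.iterate_add_apply,
      show i + 1 + (j + 1) = i + j + 1 + 1 by omega]
  refine ⟨fun a => ?_, fun a b b' => ?_, ?_, fun i j a b => ⟨hadd4 a i j, by rw [hadd4], ?_⟩⟩
  · let T : A →+ A := AddMonoidHom.mk' (fun b => b + Wop p σ ρ (Ω a) b) fun b b' => by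
      rw [hadd]; abel
    have hinj : Function.Injective T := by
      refine (injective_iff_map_eq_zero T).2 fun b hb => ?_
      have hb' : b = -Wop p σ ρ (Ω a) b := eq_neg_of_add_eq_zero_left hb
      have hall : ∀ k, b ∈ leftPower A k := by
        intro k
        induction k with
        | zero => rw [leftPower_zero]; trivial
        | succ k ih => rw [hb']; exact neg_mem (hmem _ _ _ ih)
      have := hall n
      rwa [hbot, AddSubgroup.mem_bot] at this
    obtain ⟨a', ha'⟩ := Finite.surjective_of_injective hinj (-a)
    refine ⟨a', ?_⟩
    rw [hcirc', add_assoc]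
    exact (congrArg (a + ·) ha').trans (add_neg_cancel a)
  · rw [hstar', hstar', hstar', hadd]
  · have hle : ∀ k, levels star' k ≤ leftPower A k := by
      intro k
      induction k with
      | zero => rw [leftPower_zero]; exact le_top
      | succ k ih =>
        refine (AddSubgroup.closure_le _).2 ?_
        rintro _ ⟨x, y, hy, rfl⟩
        rw [hstar']
        exact hmem _ _ _ (ih hy)
    exact eq_bot_iff.2 (hbot ▸ hle n)
  · rw [hpow, show (fun y => circ' a y) = U (Ω a) from funext (hcirc a)]
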